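/- For the Lorentz density n(σ) = 4 ω_p² σ² γ / [(ω₀² − σ²)² + σ²γ²] with ω_p, ω₀, γ > 0, and any ζ with Im ζ > 0: ∫_{-∞}^{∞} n(σ)/(σ − ζ) dσ = 4π ζ χ_L(ζ) = 4π ζ ω_p²/(ω₀² − ζ² − iγζ). -/

import Mathlib

open MeasureTheory Filter Topology

/-- A function holomorphic on the closed upper half-plane with quadratic decay has vanishing
integral along the real line. -/
theorem integrable_and_integral_eq_zero_of_quadratic_decay {f : ℂ → ℂ} {C : ℝ}
    (hf : ∀ z : ℂ, 0 ≤ z.im → DifferentiableAt ℂ f z)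
    (hC : ∀ z : ℂ, 0 ≤ z.im → ‖f z‖ ≤ C * (1 + ‖z‖ ^ 2)⁻¹) :
    Integrable (fun x : ℝ => f x) ∧ ∫ x : ℝ, f x = 0 := by
  have hcont : Continuous fun x : ℝ => f x := continuous_iff_continuousAt.2 fun x =>
    ContinuousAt.comp (f := fun x : ℝ => (x : ℂ)) (g := f) (hf x (by simp)).continuousAt
      Complex.continuous_ofReal.continuousAt
  have hint : Integrable (fun x : ℝ => f x) := by
    refine (integrable_inv_one_add_sq.const_mul C).mono' hcont.aestronglyMeasurable
      (.of_forall fun x => ?_)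
    simpa using hC x (by simp)
  refine ⟨hint, ?_⟩
  have hC0 : 0 ≤ C := by simpa using (norm_nonneg _).trans (hC 0 (by simp))
  have hlim : Tendsto (fun R : ℝ => ∫ x in -R..R, f x) atTop (𝓝 (∫ x : ℝ, f x)) :=
    intervalIntegral_tendsto_integral hint tendsto_neg_atTop_atBot tendsto_id
  have hbound : ∀ R : ℝ, 0 < R → ‖∫ x in -R..R, f x‖ ≤ 4 * C * R⁻¹ := by
    intro R hR
    have hdecay : ∀ z : ℂ, 0 ≤ z.im → R ≤ ‖z‖ → ‖f z‖ ≤ C * (R ^ 2)⁻¹ := by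
      intro z hz hRz
      refine (hC z hz).trans ?_
      gcongr
      nlinarith
    have hrect := Complex.integral_boundary_rect_eq_zero_of_differentiableOn f (-R : ℂ)
      (R + R * Complex.I) (fun z hz => by
        refine (hf z ?_).differentiableWithinAt
        have := hz.2
        simp [Set.uIcc_of_le hR.le] at this
        exact this.1)
    simp only [Complex.neg_re, Complex.neg_im, Complex.add_re, Complex.add_im, Complex.ofReal_re,
      Complex.ofReal_im, Complex.mul_re, Complex.mul_im, Complex.I_re, Complex.I_im, mul_zero,
      mul_one, sub_zero, add_zero, zero_add, neg_zero, Complex.ofReal_zero, zero_mul,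
      smul_eq_mul, Complex.ofReal_neg] at hrect
    have htop : ‖∫ x in -R..R, f (x + R * Complex.I)‖ ≤ C * (R ^ 2)⁻¹ * |R - -R| :=
      intervalIntegral.norm_integral_le_of_norm_le_const fun x _ => hdecay _ (by simp [hR.le])
        (by simpa [abs_of_pos hR] using Complex.abs_im_le_norm (x + R * Complex.I))
    have hside : ∀ s : ℝ, |s| = R →
        ‖∫ y in (0 : ℝ)..R, f (s + y * Complex.I)‖ ≤ C * (R ^ 2)⁻¹ * |R - 0| := fun s hs =>
      intervalIntegral.norm_integral_le_of_norm_le_const fun y hy => by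
        rw [Set.uIoc_of_le hR.le] at hy
        refine hdecay _ (by simpa using hy.1.le) ?_
        simpa [hs] using Complex.abs_re_le_norm (s + y * Complex.I)
    have hright := hside R (abs_of_pos hR)
    have hleft := hside (-R) (by simp [abs_of_pos hR])
    rw [Complex.ofReal_neg] at hleft
    have key : ∫ x in -R..R, f x = (∫ x in -R..R, f (x + R * Complex.I))
        - Complex.I * (∫ y in (0 : ℝ)..R, f (R + y * Complex.I))
        + Complex.I * (∫ y in (0 : ℝ)..R, f (-R + y * Complex.I)) := by
      linear_combination hrect
    rw [key]
    refine (norm_add_le _ _).trans ?_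
    grw [norm_sub_le]
    simp only [norm_mul, Complex.norm_I, one_mul]
    grw [htop, hright, hleft]
    rw [sub_neg_eq_add, sub_zero, abs_of_pos hR, abs_of_pos (by linarith : 0 < R + R)]
    apply le_of_eq
    field_simp
    ring
  refine tendsto_nhds_unique hlim (squeeze_zero_norm' (a := fun R : ℝ => 4 * C * R⁻¹) ?_ ?_)
  · filter_upwards [eventually_gt_atTop 0] with R hR using hbound R hR
  · simpa using tendsto_inv_atTop_zero.const_mul (4 * C)

theorem one_add_norm_le_mul_norm_sub {a z : ℂ} (ha : a.im < 0) (hz : 0 ≤ z.im) :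
    1 + ‖z‖ ≤ (1 + (‖a‖ + 1) / (-a.im)) * ‖z - a‖ := by
  have h₁ : -a.im ≤ ‖z - a‖ := by
    have := (le_abs_self _).trans (Complex.abs_im_le_norm (z - a))
    rw [Complex.sub_im] at this
    linarith
  have h₂ : ‖z‖ ≤ ‖z - a‖ + ‖a‖ := by simpa using norm_add_le (z - a) a
  have h₃ : ‖a‖ + 1 ≤ (‖a‖ + 1) / (-a.im) * ‖z - a‖ := by
    rw [div_mul_eq_mul_div, le_div_iff₀ (by linarith)]
    gcongr
  linarith

theorem sub_ne_zero_of_im_neg {a z : ℂ} (ha : a.im < 0) (hz : 0 ≤ z.im) : z - a ≠ 0 := by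
  intro h
  rw [sub_eq_zero] at h
  rw [h] at hz
  linarith

theorem integral_linear_div_three_lower_poles {a b c : ℂ} (ha : a.im < 0) (hb : b.im < 0)
    (hc : c.im < 0) (α β : ℂ) :
    Integrable (fun x : ℝ => (α * x + β) / ((x - a) * (x - b) * (x - c))) ∧
      ∫ x : ℝ, (α * x + β) / ((x - a) * (x - b) * (x - c)) = 0 := by
  let K : ℂ → ℝ := fun w => 1 + (‖w‖ + 1) / (-w.im)
  have hK : ∀ w : ℂ, w.im < 0 → 0 < K w := fun w hw => by
    have : 0 < -w.im := by linarith
    positivity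
  have hKa := hK a ha
  have hKb := hK b hb
  have hKc := hK c hc
  refine integrable_and_integral_eq_zero_of_quadratic_decay
    (f := fun z : ℂ => (α * z + β) / ((z - a) * (z - b) * (z - c)))
    (C := (‖α‖ + ‖β‖) * (K a * K b * K c)) ?_ ?_
  · intro z hz
    have h := mul_ne_zero (mul_ne_zero (sub_ne_zero_of_im_neg ha hz)
      (sub_ne_zero_of_im_neg hb hz)) (sub_ne_zero_of_im_neg hc hz)
    fun_prop (disch := exact h)
  · intro z hz
    have hza := norm_pos_iff.2 (sub_ne_zero_of_im_neg ha hz)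
    have hzb := norm_pos_iff.2 (sub_ne_zero_of_im_neg hb hz)
    have hzc := norm_pos_iff.2 (sub_ne_zero_of_im_neg hc hz)
    have hnum : ‖α * z + β‖ ≤ (‖α‖ + ‖β‖) * (1 + ‖z‖) := by
      have := norm_add_le (α * z) β
      rw [norm_mul] at this
      nlinarith [norm_nonneg α, norm_nonneg β, norm_nonneg z,
        mul_nonneg (norm_nonneg β) (norm_nonneg z)]
    have hden : (1 + ‖z‖) * (1 + ‖z‖) * (1 + ‖z‖) ≤
        (K a * ‖z - a‖) * (K b * ‖z - b‖) * (K c * ‖z - c‖) := by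
      gcongr
      · exact one_add_norm_le_mul_norm_sub ha hz
      · exact one_add_norm_le_mul_norm_sub hb hz
      · exact one_add_norm_le_mul_norm_sub hc hz
    simp only [norm_div, norm_mul]
    rw [div_le_iff₀ (by positivity), mul_right_comm, ← div_eq_mul_inv,
      le_div_iff₀ (by positivity)]
    calc ‖α * z + β‖ * (1 + ‖z‖ ^ 2)
        ≤ (‖α‖ + ‖β‖) * (1 + ‖z‖) * ((1 + ‖z‖) * (1 + ‖z‖)) := by
          gcongr
          nlinarith [norm_nonneg z]
      _ = (‖α‖ + ‖β‖) * ((1 + ‖z‖) * (1 + ‖z‖) * (1 + ‖z‖)) := by ring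
      _ ≤ (‖α‖ + ‖β‖) * ((K a * ‖z - a‖) * (K b * ‖z - b‖) * (K c * ‖z - c‖)) := by gcongr
      _ = _ := by ring

open scoped ComplexConjugate in
theorem integral_poisson_kernel {ζ : ℂ} (hζ : 0 < ζ.im) :
    Integrable (fun x : ℝ => (ζ - conj ζ) / ((x - ζ) * (x - conj ζ))) ∧
      ∫ x : ℝ, (ζ - conj ζ) / ((x - ζ) * (x - conj ζ)) = 2 * Real.pi * Complex.I := by
  let y : NNReal := ⟨ζ.im, hζ.le⟩
  have hy : y ≠ 0 := fun h => hζ.ne' (congrArg NNReal.toReal h)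
  have heq : (fun x : ℝ => (ζ - conj ζ) / ((x - ζ) * (x - conj ζ))) = fun x : ℝ =>
      2 * Real.pi * Complex.I * ((ProbabilityTheory.cauchyPDFReal ζ.re y x : ℝ) : ℂ) := by
    funext x
    have hden : ((x : ℂ) - ζ) * (x - conj ζ) = (((x - ζ.re) ^ 2 + ζ.im ^ 2 : ℝ) : ℂ) := by
      rw [show (x : ℂ) - conj ζ = conj ((x : ℂ) - ζ) by simp, Complex.mul_conj,
        Complex.normSq_apply]
      simp [pow_two]
    have hpos : (((x - ζ.re) ^ 2 + ζ.im ^ 2 : ℝ) : ℂ) ≠ 0 := by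
      exact_mod_cast (by positivity : (x - ζ.re) ^ 2 + ζ.im ^ 2 ≠ 0)
    have hπ : (Real.pi : ℂ) ≠ 0 := by exact_mod_cast Real.pi_ne_zero
    rw [hden, Complex.sub_conj, ProbabilityTheory.cauchyPDFReal_def, Complex.ofReal_mul,
      Complex.ofReal_mul, Complex.ofReal_mul, Complex.ofReal_inv, Complex.ofReal_inv]
    change _ = 2 * (Real.pi : ℂ) * Complex.I *
      ((Real.pi : ℂ)⁻¹ * (ζ.im : ℂ) * (((x - ζ.re) ^ 2 + ζ.im ^ 2 : ℝ) : ℂ)⁻¹)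
    field_simp
    push_cast
    ring
  constructor
  · rw [heq]
    exact (ProbabilityTheory.integrable_cauchyPDFReal ζ.re).ofReal.const_mul _
  · rw [heq, integral_const_mul, integral_complex_ofReal,
      ProbabilityTheory.integral_cauchyPDFReal_eq_one _ hy]
    simp

open scoped ComplexConjugate in
/-- Two poles in the lower half-plane and one, at `ζ`, in the upper: the integral is the residue
contribution of `ζ`. -/
theorem integral_div_two_lower_one_upper_pole {a b ζ : ℂ} (ha : a.im < 0) (hb : b.im < 0)
    (hζ : 0 < ζ.im) :
    Integrable (fun x : ℝ => (x : ℂ) / ((x - a) * (x - b) * (x - ζ))) ∧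
      ∫ x : ℝ, (x : ℂ) / ((x - a) * (x - b) * (x - ζ)) =
        2 * Real.pi * Complex.I * (ζ / ((ζ - a) * (ζ - b))) := by
  have hζa := sub_ne_zero_of_im_neg ha hζ.le
  have hζb := sub_ne_zero_of_im_neg hb hζ.le
  have hc : (conj ζ).im < 0 := by simpa using hζ
  obtain ⟨hi₁, he₁⟩ := integral_linear_div_three_lower_poles ha hb hc
    (1 - (ζ - conj ζ) * ζ / ((ζ - a) * (ζ - b))) ((ζ - conj ζ) * (a * b) / ((ζ - a) * (ζ - b)))
  obtain ⟨hi₂, he₂⟩ := integral_poisson_kernel hζ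
  have hi₂ := hi₂.const_mul (ζ / ((ζ - a) * (ζ - b)))
  have heq : (fun x : ℝ => (x : ℂ) / ((x - a) * (x - b) * (x - ζ))) = fun x : ℝ =>
      ((1 - (ζ - conj ζ) * ζ / ((ζ - a) * (ζ - b))) * x +
        (ζ - conj ζ) * (a * b) / ((ζ - a) * (ζ - b))) / ((x - a) * (x - b) * (x - conj ζ)) +
      ζ / ((ζ - a) * (ζ - b)) * ((ζ - conj ζ) / ((x - ζ) * (x - conj ζ))) := by
    funext x
    have h₁ := sub_ne_zero_of_im_neg ha (z := (x : ℂ)) (by simp)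
    have h₂ := sub_ne_zero_of_im_neg hb (z := (x : ℂ)) (by simp)
    have h₃ := sub_ne_zero_of_im_neg hc (z := (x : ℂ)) (by simp)
    have h₄ : (x : ℂ) - ζ ≠ 0 := by
      intro h
      have := congrArg Complex.im h
      simp [hζ.ne'] at this
    generalize conj ζ = c at *
    field_simp
    ring
  rw [heq]
  refine ⟨hi₁.add hi₂, ?_⟩
  rw [integral_add hi₁ hi₂, he₁, integral_const_mul, he₂]
  ring

theorem integral_div_three_upper_poles {a b ζ : ℂ} (ha : a.im < 0) (hb : b.im < 0)
    (hζ : 0 < ζ.im) :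
    Integrable (fun x : ℝ => (x : ℂ) / ((x + a) * (x + b) * (x - ζ))) ∧
      ∫ x : ℝ, (x : ℂ) / ((x + a) * (x + b) * (x - ζ)) = 0 := by
  obtain ⟨hi, he⟩ := integral_linear_div_three_lower_poles ha hb (c := -ζ) (by simpa using hζ) 1 0
  have heq : (fun x : ℝ => (x : ℂ) / ((x + a) * (x + b) * (x - ζ))) = fun x : ℝ =>
      (fun t : ℝ => (1 * (t : ℂ) + 0) / ((t - a) * (t - b) * (t - -ζ))) (-x) := by
    funext x
    simp only [Complex.ofReal_neg]
    rw [show (-(x : ℂ) - a) * (-x - b) * (-x - -ζ) = -((x + a) * (x + b) * (x - ζ)) by ring,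
      show 1 * -(x : ℂ) + 0 = -x by ring, neg_div_neg_eq]
  rw [heq]
  exact ⟨hi.comp_neg, (integral_neg_eq_self _ _).trans he⟩

/-- The roots of `z² + iγz - ω₀²` lie in the open lower half-plane. -/
theorem im_neg_of_lorentz_root {ω₀ γ : ℝ} (hω₀ : 0 < ω₀) (hγ : 0 < γ) {a : ℂ}
    (h : a ^ 2 + Complex.I * γ * a - ω₀ ^ 2 = 0) : a.im < 0 := by
  have hre := congrArg Complex.re h
  have him := congrArg Complex.im h
  simp [pow_two] at hre him
  by_contra! hy
  have hx : a.re = 0 := by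
    have : a.re * (2 * a.im + γ) = 0 := by linear_combination him
    exact (mul_eq_zero.1 this).resolve_right (by positivity)
  rw [hx] at hre
  nlinarith [mul_nonneg hγ.le hy, mul_pos hω₀ hω₀, mul_nonneg hy hy]

theorem exists_lorentz_factorization {ω₀ γ : ℝ} (hω₀ : 0 < ω₀) (hγ : 0 < γ) :
    ∃ a b : ℂ, a.im < 0 ∧ b.im < 0 ∧
      ∀ z : ℂ, (ω₀ : ℂ) ^ 2 - z ^ 2 - Complex.I * γ * z = -((z - a) * (z - b)) := by
  obtain ⟨s, hs⟩ := IsAlgClosed.exists_pow_nat_eq (4 * (ω₀ : ℂ) ^ 2 - γ ^ 2) zero_lt_two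
  have hfac : ∀ z : ℂ, (ω₀ : ℂ) ^ 2 - z ^ 2 - Complex.I * γ * z =
      -((z - (-Complex.I * γ + s) / 2) * (z - (-Complex.I * γ - s) / 2)) := fun z => by
    linear_combination -(1 / 4 : ℂ) * hs + (γ : ℂ) ^ 2 / 4 * Complex.I_sq
  refine ⟨_, _, im_neg_of_lorentz_root hω₀ hγ ?_, im_neg_of_lorentz_root hω₀ hγ ?_, hfac⟩
  · linear_combination -hfac ((-Complex.I * γ + s) / 2)
  · linear_combination -hfac ((-Complex.I * γ - s) / 2)

/-- (Cauchy-transform representation of the Lorentz susceptibility.)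
For `n(σ) = 4 ωp² σ² γ / [(ω₀² − σ²)² + σ²γ²]` with `ωp, ω₀, γ > 0` and `Im ζ > 0`:
`∫ n(σ)/(σ − ζ) dσ = 4π ζ χ_L(ζ) = 4π ζ ωp²/(ω₀² − ζ² − iγζ)`. -/
theorem lorentz_density_cauchy_transform
    (ωp ω₀ γ : ℝ) (hωp : 0 < ωp) (hω₀ : 0 < ω₀) (hγ : 0 < γ)
    (ζ : ℂ) (hζ : 0 < ζ.im) :
    (∫ σ : ℝ, ((4 * ωp ^ 2 * σ ^ 2 * γ /
        ((ω₀ ^ 2 - σ ^ 2) ^ 2 + σ ^ 2 * γ ^ 2) : ℝ) : ℂ) / ((σ : ℂ) - ζ))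
      = 4 * Real.pi * ζ * ((ωp ^ 2 : ℂ) / (ω₀ ^ 2 - ζ ^ 2 - Complex.I * γ * ζ)) := by
  obtain ⟨a, b, ha, hb, hfac⟩ := exists_lorentz_factorization hω₀ hγ
  obtain ⟨hi₁, he₁⟩ := integral_div_two_lower_one_upper_pole ha hb hζ
  obtain ⟨hi₂, he₂⟩ := integral_div_three_upper_poles ha hb hζ
  have heq : (fun σ : ℝ => ((4 * ωp ^ 2 * σ ^ 2 * γ /
      ((ω₀ ^ 2 - σ ^ 2) ^ 2 + σ ^ 2 * γ ^ 2) : ℝ) : ℂ) / ((σ : ℂ) - ζ)) = fun σ : ℝ =>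
      2 * Complex.I * ωp ^ 2 * ((σ : ℂ) / ((σ - a) * (σ - b) * (σ - ζ)) -
        (σ : ℂ) / ((σ + a) * (σ + b) * (σ - ζ))) := by
    funext σ
    have h₁ := sub_ne_zero_of_im_neg ha (z := (σ : ℂ)) (by simp)
    have h₂ := sub_ne_zero_of_im_neg hb (z := (σ : ℂ)) (by simp)
    have h₃ : (σ : ℂ) + a ≠ 0 := fun h =>
      sub_ne_zero_of_im_neg ha (z := ((-σ : ℝ) : ℂ)) (by simp)
        (by push_cast; linear_combination -h)
    have h₄ : (σ : ℂ) + b ≠ 0 := fun h =>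
      sub_ne_zero_of_im_neg hb (z := ((-σ : ℝ) : ℂ)) (by simp)
        (by push_cast; linear_combination -h)
    have h₅ : (σ : ℂ) - ζ ≠ 0 := by
      intro h
      have := congrArg Complex.im h
      simp [hζ.ne'] at this
    have hplus := hfac σ
    have hminus := hfac (-σ)
    have hden : ((ω₀ : ℂ) ^ 2 - σ ^ 2) ^ 2 + σ ^ 2 * γ ^ 2 =
        ((σ - a) * (σ - b)) * ((σ + a) * (σ + b)) := by
      calc ((ω₀ : ℂ) ^ 2 - σ ^ 2) ^ 2 + σ ^ 2 * γ ^ 2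
          = (ω₀ ^ 2 - σ ^ 2 - Complex.I * γ * σ) *
              (ω₀ ^ 2 - (-σ) ^ 2 - Complex.I * γ * (-σ)) := by
            linear_combination (σ : ℂ) ^ 2 * γ ^ 2 * Complex.I_sq
        _ = _ := by rw [hplus, hminus]; ring
    have hdiff : ((σ : ℂ) + a) * (σ + b) - (σ - a) * (σ - b) = -2 * Complex.I * γ * σ := by
      linear_combination hminus - hplus
    push_cast
    rw [hden]
    have hsub : (σ : ℂ) / ((σ - a) * (σ - b) * (σ - ζ)) - σ / ((σ + a) * (σ + b) * (σ - ζ)) =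
        σ * (((σ : ℂ) + a) * (σ + b) - (σ - a) * (σ - b)) /
          (((σ - a) * (σ - b)) * ((σ + a) * (σ + b)) * (σ - ζ)) := by
      field_simp
    rw [hsub, hdiff, div_div, ← mul_div_assoc]
    congr 1
    linear_combination 4 * (ωp : ℂ) ^ 2 * σ ^ 2 * γ * Complex.I_sq
  rw [heq, integral_const_mul, integral_sub hi₁ hi₂, he₁, he₂, hfac ζ, div_neg]
  linear_combination 4 * Real.pi * ωp ^ 2 * (ζ / ((ζ - a) * (ζ - b))) * Complex.I_sq
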